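/- Let T be an invertible n×n complex matrix with Im T := (T - Tᴴ)/(2i) positive semidefinite, and define log T := -i ∫₀^∞ ((T + it·I)⁻¹ - (1 + it)⁻¹·I) dt. Then there exists an integer k such that tr(log T) = Log(det T) + 2kπi, where Log denotes the principal branch of the complex logarithm. -/

import Mathlib

open Matrix MeasureTheory
open scoped ComplexOrder

attribute [local instance] Matrix.normedAddCommGroup Matrix.normedSpace

/-- The matrix logarithm `log T := -i ∫₀^∞ ((T + it·I)⁻¹ - (1+it)⁻¹·I) dt` of a
matrix with positive semidefinite imaginary part. -/
noncomputable def matLog {n : ℕ} (T : Matrix (Fin n) (Fin n) ℂ) : Matrix (Fin n) (Fin n) ℂ :=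
  (-Complex.I) •
    ∫ t in Set.Ioi (0 : ℝ),
      ((T + (Complex.I * (t : ℂ)) • (1 : Matrix (Fin n) (Fin n) ℂ))⁻¹
        - (1 + Complex.I * (t : ℂ))⁻¹ • (1 : Matrix (Fin n) (Fin n) ℂ))

namespace Matrix

open Filter Topology

/-- Jacobi's formula for `z ↦ det (A + z • 1)`. -/
theorem hasDerivAt_det_add_smul_one {m : Type*} [Fintype m] [DecidableEq m] (A : Matrix m m ℂ)
    (w : ℂ) (h : IsUnit (A + w • (1 : Matrix m m ℂ)).det) :
    HasDerivAt (fun z : ℂ => (A + z • (1 : Matrix m m ℂ)).det)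
      ((A + w • (1 : Matrix m m ℂ)).det * (A + w • (1 : Matrix m m ℂ))⁻¹.trace) w := by
  set B := A + w • (1 : Matrix m m ℂ) with hB
  have hfun : (fun z : ℂ => (A + z • (1 : Matrix m m ℂ)).det) =
      fun z => B.det * (det (1 + (Polynomial.X : Polynomial ℂ) • B⁻¹.map Polynomial.C)).eval
        (z - w) := by
    funext z
    have heval : (det (1 + (Polynomial.X : Polynomial ℂ) • B⁻¹.map Polynomial.C)).eval (z - w)
        = det (1 + (z - w) • B⁻¹) := by
      rw [← Polynomial.coe_evalRingHom, RingHom.map_det]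
      congr 1
      ext i j
      by_cases hij : i = j <;> simp [hij, mul_comm (z - w)]
    rw [heval, ← det_mul]
    congr 1
    rw [mul_add, mul_one, mul_smul_comm, mul_nonsing_inv _ h, hB, sub_smul]
    abel
  rw [hfun]
  have hp := (det (1 + (Polynomial.X : Polynomial ℂ) • B⁻¹.map Polynomial.C)).hasDerivAt (w - w)
  rw [sub_self, derivative_det_one_add_X_smul] at hp
  have hp' : HasDerivAt (fun z => (det (1 + (Polynomial.X : Polynomial ℂ) •
      B⁻¹.map Polynomial.C)).eval (z - w)) B⁻¹.trace w :=
    HasDerivAt.comp_sub_const w w (by rwa [sub_self])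
  exact hp'.const_mul _

/-- If `Im T ≥ 0` and `T` is invertible, then so is `T + it` for `t ≥ 0`. -/
theorem isUnit_det_add_I_mul_smul_one {m : Type*} [Fintype m] [DecidableEq m] {T : Matrix m m ℂ}
    (hTinv : IsUnit T) (hT : ((2 * Complex.I)⁻¹ • (T - Tᴴ)).PosSemidef) {t : ℝ} (ht : 0 ≤ t) :
    IsUnit (T + (Complex.I * (t : ℂ)) • (1 : Matrix m m ℂ)).det := by
  rcases ht.eq_or_lt with rfl | ht
  · simpa using (isUnit_iff_isUnit_det T).1 hTinv
  rw [isUnit_iff_ne_zero]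
  intro hdet
  obtain ⟨v, hv, hTv⟩ := exists_mulVec_eq_zero_iff.2 hdet
  apply hv
  rw [← dotProduct_star_self_eq_zero]
  have hTv' : T *ᵥ v = -((Complex.I * (t : ℂ)) • v) := by
    rw [add_mulVec, smul_mulVec, one_mulVec] at hTv
    exact eq_neg_of_add_eq_zero_left hTv
  have hTHv : star v ⬝ᵥ (Tᴴ *ᵥ v) = Complex.I * t * (star v ⬝ᵥ v) := by
    rw [dotProduct_mulVec, ← star_mulVec, hTv', star_neg, star_smul, neg_dotProduct,
      smul_dotProduct]
    simp
  have hpos := hT.dotProduct_mulVec_nonneg v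
  have hval : star v ⬝ᵥ (((2 * Complex.I)⁻¹ • (T - Tᴴ)) *ᵥ v) = -(t * (star v ⬝ᵥ v)) := by
    rw [smul_mulVec, sub_mulVec, dotProduct_smul, dotProduct_sub, hTHv, hTv', dotProduct_neg,
      dotProduct_smul, smul_eq_mul, smul_eq_mul]
    field_simp
    ring
  rw [hval] at hpos
  have ht' : (0 : ℂ) < t := by exact_mod_cast ht
  have hvv : 0 ≤ star v ⬝ᵥ v := dotProduct_star_self_nonneg v
  have : (t : ℂ) * (star v ⬝ᵥ v) = 0 :=
    le_antisymm (neg_nonneg.1 hpos) (mul_nonneg ht'.le hvv)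
  exact (mul_eq_zero.1 this).resolve_left ht'.ne'

end Matrix

open Filter Topology

theorem one_add_I_mul_ofReal_ne_zero (t : ℝ) : 1 + Complex.I * (t : ℂ) ≠ 0 := by
  intro h
  simpa using congrArg Complex.re h

theorem tendsto_one_add_I_mul_ofReal_inv_atTop :
    Tendsto (fun t : ℝ => (1 + Complex.I * (t : ℂ))⁻¹) atTop (𝓝 0) := by
  apply tendsto_inv₀_cobounded.comp
  rw [← tendsto_norm_atTop_iff_cobounded]
  refine tendsto_atTop_mono (fun t => ?_) tendsto_id
  have him : t = (1 + Complex.I * (t : ℂ)).im := by simp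
  exact him.le.trans ((le_abs_self _).trans (Complex.abs_im_le_norm _))

/-- The integrand of `matLog`. -/
noncomputable def matLogIntegrand {n : ℕ} (T : Matrix (Fin n) (Fin n) ℂ) (t : ℝ) :
    Matrix (Fin n) (Fin n) ℂ :=
  (T + (Complex.I * (t : ℂ)) • (1 : Matrix (Fin n) (Fin n) ℂ))⁻¹
    - (1 + Complex.I * (t : ℂ))⁻¹ • (1 : Matrix (Fin n) (Fin n) ℂ)

section

variable {n : ℕ} {T : Matrix (Fin n) (Fin n) ℂ}

theorem add_I_mul_smul_one_eq_smul (T : Matrix (Fin n) (Fin n) ℂ) (t : ℝ) :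
    T + (Complex.I * (t : ℂ)) • (1 : Matrix (Fin n) (Fin n) ℂ) =
      (1 + Complex.I * (t : ℂ)) • (1 + (1 + Complex.I * (t : ℂ))⁻¹ • (T - 1)) := by
  rw [smul_add, smul_smul, mul_inv_cancel₀ (one_add_I_mul_ofReal_ne_zero t), one_smul, add_smul,
    one_smul]
  abel

theorem tendsto_one_add_inv_smul_atTop (S : Matrix (Fin n) (Fin n) ℂ) :
    Tendsto (fun t : ℝ => 1 + (1 + Complex.I * (t : ℂ))⁻¹ • S) atTop (𝓝 1) := by
  simpa using (tendsto_one_add_I_mul_ofReal_inv_atTop.smul_const S).const_add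
    (1 : Matrix (Fin n) (Fin n) ℂ)

theorem tendsto_det_div_atTop (T : Matrix (Fin n) (Fin n) ℂ) :
    Tendsto (fun t : ℝ => (T + (Complex.I * (t : ℂ)) • (1 : Matrix (Fin n) (Fin n) ℂ)).det *
      ((1 + Complex.I * (t : ℂ)) ^ n)⁻¹) atTop (𝓝 1) := by
  have h := ((continuous_id.matrix_det (n := Fin n) (R := ℂ)).tendsto 1).comp
    (tendsto_one_add_inv_smul_atTop (T - 1))
  simp only [id, det_one] at h
  refine h.congr fun t => ?_
  rw [add_I_mul_smul_one_eq_smul, det_smul, Fintype.card_fin, mul_comm, ← mul_assoc,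
    inv_mul_cancel₀ (pow_ne_zero _ (one_add_I_mul_ofReal_ne_zero t)), one_mul]
  rfl

theorem continuousOn_matLogIntegrand (hTinv : IsUnit T)
    (hT : ((2 * Complex.I)⁻¹ • (T - Tᴴ)).PosSemidef) :
    ContinuousOn (matLogIntegrand T) (Set.Ici 0) := by
  have hA : Continuous fun t : ℝ => T + (Complex.I * (t : ℂ)) • (1 : Matrix (Fin n) (Fin n) ℂ) := by
    fun_prop
  unfold matLogIntegrand
  refine ContinuousOn.sub ?_ ?_
  · simp only [Matrix.inv_def, Ring.inverse_eq_inv']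
    exact (hA.matrix_det.continuousOn.inv₀ fun t ht =>
      (isUnit_det_add_I_mul_smul_one hTinv hT ht).ne_zero).smul hA.matrix_adjugate.continuousOn
  · refine Continuous.continuousOn ?_
    exact (Continuous.inv₀ (by fun_prop) one_add_I_mul_ofReal_ne_zero).smul continuous_const

theorem tendsto_sq_smul_matLogIntegrand (T : Matrix (Fin n) (Fin n) ℂ) :
    Tendsto (fun t : ℝ => (1 + Complex.I * (t : ℂ)) ^ 2 • matLogIntegrand T t) atTop
      (𝓝 (1 - T)) := by
  set E : ℝ → Matrix (Fin n) (Fin n) ℂ := fun t => 1 + (1 + Complex.I * (t : ℂ))⁻¹ • (T - 1) with hE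
  have hEt : Tendsto E atTop (𝓝 1) := tendsto_one_add_inv_smul_atTop (T - 1)
  have hdet : Tendsto (fun t => (E t).det) atTop (𝓝 1) := by
    have := ((continuous_id.matrix_det (n := Fin n) (R := ℂ)).tendsto 1).comp hEt
    simpa only [id, det_one] using! this
  have hadj : Tendsto (fun t => (E t).adjugate) atTop (𝓝 1) := by
    have := ((continuous_id.matrix_adjugate (n := Fin n) (R := ℂ)).tendsto 1).comp hEt
    simpa only [id, adjugate_one] using! this
  have hinv : Tendsto (fun t => (E t)⁻¹) atTop (𝓝 1) := by
    simp only [Matrix.inv_def, Ring.inverse_eq_inv']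
    simpa using (hdet.inv₀ one_ne_zero).smul hadj
  have hlim : Tendsto (fun t => (E t)⁻¹ * (1 - T)) atTop (𝓝 (1 - T)) := by
    simpa using hinv.mul_const (1 - T)
  refine hlim.congr' ?_
  filter_upwards [hdet.eventually_ne one_ne_zero] with t ht
  have hc := one_add_I_mul_ofReal_ne_zero t
  have hu : IsUnit (E t).det := isUnit_iff_ne_zero.2 ht
  have hsub : (1 : Matrix (Fin n) (Fin n) ℂ) - E t = (1 + Complex.I * (t : ℂ))⁻¹ • (1 - T) := by
    rw [hE, ← neg_sub T 1, smul_neg, sub_add_cancel_left]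
  have hI : (T + (Complex.I * (t : ℂ)) • (1 : Matrix (Fin n) (Fin n) ℂ))⁻¹ =
      (1 + Complex.I * (t : ℂ))⁻¹ • (E t)⁻¹ := by
    apply Matrix.inv_eq_right_inv
    rw [add_I_mul_smul_one_eq_smul, smul_mul_smul_comm, mul_inv_cancel₀ hc, one_smul]
    exact mul_nonsing_inv _ hu
  have hres : (E t)⁻¹ - 1 = (1 + Complex.I * (t : ℂ))⁻¹ • ((E t)⁻¹ * (1 - T)) := by
    rw [← mul_smul_comm, ← hsub, mul_sub, nonsing_inv_mul _ hu, mul_one]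
  rw [matLogIntegrand, hI, ← smul_sub, hres, smul_smul, smul_smul]
  rw [show (1 + Complex.I * (t : ℂ)) ^ 2 *
    (1 + Complex.I * (t : ℂ))⁻¹ * (1 + Complex.I * (t : ℂ))⁻¹ = 1 by field_simp, one_smul]

theorem integrableOn_matLogIntegrand (hTinv : IsUnit T)
    (hT : ((2 * Complex.I)⁻¹ • (T - Tᴴ)).PosSemidef) :
    IntegrableOn (ε := Fin n → Fin n → ℂ) (matLogIntegrand T) (Set.Ioi 0) := by
  have hO : matLogIntegrand T =O[atTop] fun t : ℝ => (1 + t ^ 2)⁻¹ := by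
    have h1 := (tendsto_sq_smul_matLogIntegrand T).isBigO_one ℂ
    have h2 :
        (fun t : ℝ => ((1 + Complex.I * (t : ℂ)) ^ 2)⁻¹ • (1 + Complex.I * (t : ℂ)) ^ 2 •
          matLogIntegrand T t) =O[atTop] fun t => ((1 + Complex.I * (t : ℂ)) ^ 2)⁻¹ • (1 : ℂ) :=
      (Asymptotics.isBigO_refl (fun t : ℝ => ((1 + Complex.I * (t : ℂ)) ^ 2)⁻¹)
      atTop).smul h1
    refine (h2.congr_left fun t => ?_).trans (Asymptotics.IsBigO.of_bound 1 ?_)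
    · exact inv_smul_smul₀ (pow_ne_zero 2 (one_add_I_mul_ofReal_ne_zero t)) _
    · filter_upwards with t
      have : ‖1 + Complex.I * (t : ℂ)‖ ^ 2 = 1 + t ^ 2 := by
        rw [Complex.sq_norm, Complex.normSq_apply]
        simp
        ring
      rw [norm_smul, norm_inv, norm_pow, this, norm_one, mul_one, one_mul, norm_inv]
      exact le_of_eq (by rw [Real.norm_of_nonneg (by positivity)])
  have hc : ContinuousOn (Y := Fin n → Fin n → ℂ) (matLogIntegrand T) (Set.Ici 0) :=
    continuousOn_matLogIntegrand hTinv hT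
  exact ((hc.locallyIntegrableOn measurableSet_Ici).integrableOn_of_isBigO_atTop hO
      (integrable_inv_one_add_sq.integrableAtFilter _)).mono_set Set.Ioi_subset_Ici_self

theorem matLog_eq_integral (T : Matrix (Fin n) (Fin n) ℂ) :
    matLog T = (-Complex.I) • ∫ t in Set.Ioi (0 : ℝ), matLogIntegrand T t := rfl

/-- The trace as a continuous linear map on arrays, which carry the sup norm that `matLog` uses. -/
noncomputable def traceCLM (n : ℕ) : (Fin n → Fin n → ℂ) →L[ℂ] ℂ :=
  LinearMap.toContinuousLinearMap
    (show (Fin n → Fin n → ℂ) →ₗ[ℂ] ℂ from traceLinearMap (Fin n) ℂ ℂ)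

theorem trace_matLog (hTinv : IsUnit T) (hT : ((2 * Complex.I)⁻¹ • (T - Tᴴ)).PosSemidef) :
    (matLog T).trace =
      -Complex.I * ∫ t in Set.Ioi (0 : ℝ), (matLogIntegrand T t).trace := by
  rw [matLog_eq_integral, trace_smul, smul_eq_mul]
  congr 1
  exact ((traceCLM n).integral_comp_comm (integrableOn_matLogIntegrand hTinv hT)).symm

theorem integrableOn_trace_matLogIntegrand (hTinv : IsUnit T)
    (hT : ((2 * Complex.I)⁻¹ • (T - Tᴴ)).PosSemidef) :
    IntegrableOn (fun t => (matLogIntegrand T t).trace) (Set.Ioi 0) :=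
  (traceCLM n).integrable_comp (integrableOn_matLogIntegrand hTinv hT)

/-- The logarithmic derivative of `det (T + it) / (1 + it) ^ n` is `i tr` of the integrand of
`matLog T`. -/
theorem hasDerivAt_det_div (hTinv : IsUnit T)
    (hT : ((2 * Complex.I)⁻¹ • (T - Tᴴ)).PosSemidef) {t : ℝ} (ht : 0 ≤ t) :
    HasDerivAt
      (fun s : ℝ => (T + (Complex.I * (s : ℂ)) • (1 : Matrix (Fin n) (Fin n) ℂ)).det *
        ((1 + Complex.I * (s : ℂ)) ^ n)⁻¹)
      ((T + (Complex.I * (t : ℂ)) • (1 : Matrix (Fin n) (Fin n) ℂ)).det *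
        ((1 + Complex.I * (t : ℂ)) ^ n)⁻¹ * (Complex.I * (matLogIntegrand T t).trace)) t := by
  have hI : HasDerivAt (fun s : ℝ => Complex.I * (s : ℂ)) Complex.I t := by
    simpa using (Complex.ofRealCLM.hasDerivAt (x := t)).const_mul Complex.I
  have hD := (hasDerivAt_det_add_smul_one T _
    (isUnit_det_add_I_mul_smul_one hTinv hT ht)).comp t hI
  have hc := one_add_I_mul_ofReal_ne_zero t
  have hP := ((hI.const_add 1).pow n).inv (pow_ne_zero n hc)
  refine (hD.mul hP).congr_deriv ?_
  simp only [Function.comp_apply, Pi.inv_apply, Pi.pow_apply, matLogIntegrand, trace_sub,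
    trace_smul, trace_one, Fintype.card_fin, smul_eq_mul]
  rcases n with _ | k
  · simp
  · rw [Nat.add_sub_cancel]
    field_simp
    ring

theorem exp_trace_matLog (hTinv : IsUnit T)
    (hT : ((2 * Complex.I)⁻¹ • (T - Tᴴ)).PosSemidef) :
    Complex.exp (matLog T).trace = T.det := by
  set g : ℝ → ℂ := fun t => (matLogIntegrand T t).trace with hg
  set F : ℝ → ℂ := fun s => (T + (Complex.I * (s : ℂ)) • (1 : Matrix (Fin n) (Fin n) ℂ)).det *
    ((1 + Complex.I * (s : ℂ)) ^ n)⁻¹ with hF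
  -- `g` is only controlled on `[0, ∞)`, so extend it continuously by a constant.
  set h : ℝ → ℂ := fun t => g (max t 0) with hh
  have hhg : ∀ t, 0 ≤ t → h t = g t := fun t ht => by simp only [hh, max_eq_left ht]
  have hgc : ContinuousOn g (Set.Ici 0) :=
    (continuous_id.matrix_trace).comp_continuousOn (continuousOn_matLogIntegrand hTinv hT)
  have hhc : Continuous h :=
    hgc.comp_continuous (by fun_prop) fun t => le_max_right t 0
  have hJ : ∀ t, HasDerivAt (fun R => ∫ s in (0 : ℝ)..R, h s) (h t) t := fun t =>
    (hhc.integral_hasStrictDerivAt 0 t).hasDerivAt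
  set H : ℝ → ℂ := fun R => F R * Complex.exp (-Complex.I * ∫ s in (0 : ℝ)..R, h s) with hHdef
  have hH : ∀ t, 0 ≤ t → HasDerivAt H 0 t := fun t ht => by
    refine ((hasDerivAt_det_div hTinv hT ht).mul
      (((hJ t).const_mul (-Complex.I)).cexp)).congr_deriv ?_
    rw [hhg t ht]
    simp only [hg]
    ring
  have hconst : ∀ R, 0 ≤ R → H R = T.det := fun R hR => by
    rw [constant_of_has_deriv_right_zero (f := H) (a := 0) (b := R)
      (fun t ht => (hH t ht.1).continuousAt.continuousWithinAt)
      (fun t ht => (hH t ht.1).hasDerivWithinAt) R ⟨hR, le_rfl⟩]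
    simp [hHdef, hF]
  have hint : Tendsto (fun R => ∫ s in (0 : ℝ)..R, h s) atTop (𝓝 (∫ s in Set.Ioi 0, g s)) := by
    refine (intervalIntegral_tendsto_integral_Ioi 0
      (integrableOn_trace_matLogIntegrand hTinv hT) tendsto_id).congr' ?_
    filter_upwards [eventually_ge_atTop 0] with R hR
    refine intervalIntegral.integral_congr fun s hs => ?_
    rw [id, Set.uIcc_of_le hR] at hs
    exact (hhg s hs.1).symm
  have hlim : Tendsto H atTop (𝓝 (1 * Complex.exp (-Complex.I * ∫ s in Set.Ioi 0, g s))) :=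
    (tendsto_det_div_atTop T).mul
      ((Complex.continuous_exp.tendsto _).comp (hint.const_mul (-Complex.I)))
  have hlim' : Tendsto H atTop (𝓝 T.det) :=
    tendsto_const_nhds.congr' ((eventually_ge_atTop 0).mono fun R hR => (hconst R hR).symm)
  rw [trace_matLog hTinv hT, ← one_mul (Complex.exp _)]
  exact tendsto_nhds_unique hlim hlim'

end

/-- For an invertible matrix `T` with positive semidefinite imaginary part,
`tr (log T) = Log (det T) + 2kπi` for some integer `k`, where `Log` is the principal
branch of the complex logarithm. -/
theorem trace_matLog_eq_log_det_add (n : ℕ) (T : Matrix (Fin n) (Fin n) ℂ)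
    (hTinv : IsUnit T)
    (hT : ((2 * Complex.I)⁻¹ • (T - Tᴴ)).PosSemidef) :
    ∃ k : ℤ, (matLog T).trace = Complex.log T.det + 2 * (k : ℂ) * Real.pi * Complex.I := by
  have hdet : T.det ≠ 0 := ((isUnit_iff_isUnit_det T).1 hTinv).ne_zero
  obtain ⟨k, hk⟩ := Complex.exp_eq_exp_iff_exists_int.1
    ((exp_trace_matLog hTinv hT).trans (Complex.exp_log hdet).symm)
  exact ⟨k, by rw [hk]; ring⟩
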